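/- Fix ν > 0 and 0 < b < c. There exist a probability space carrying an inverse-gamma random variable Z (with parameter ν) and a nonnegative random variable X, independent of Z, such that 1 + Z/b and (1 + X/b)(1 + Z/c) have the same distribution. -/

import Mathlib

open MeasureTheory ProbabilityTheory Real Set

/-- Kummer's confluent hypergeometric function `Φ(α,β;z)`, via the Euler integral
`Φ(α,β;z) = (Γ(β)/(Γ(α)Γ(β−α))) ∫_0^1 t^{α−1}(1−t)^{β−α−1} e^{zt} dt`. -/
noncomputable def Phi (α β z : ℝ) : ℝ :=
  (Real.Gamma β / (Real.Gamma α * Real.Gamma (β - α))) *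
    ∫ t in Set.Ioo (0:ℝ) 1, t ^ (α - 1) * (1 - t) ^ (β - α - 1) * Real.exp (z * t)

/-- Tricomi's confluent hypergeometric function `Ψ(α,β;z)`, via the integral
`Ψ(α,β;z) = (1/Γ(α)) ∫_0^∞ e^{−zt} t^{α−1} (1+t)^{β−α−1} dt`. -/
noncomputable def Psi (α β z : ℝ) : ℝ :=
  (Real.Gamma α)⁻¹ *
    ∫ t in Set.Ioi (0:ℝ), Real.exp (-(z * t)) * t ^ (α - 1) * (1 + t) ^ (β - α - 1)

/-- The inverse-gamma law with parameter `ν`: the pushforward of the `Gamma(ν,1)`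
distribution under the map `x ↦ 1/(2x)`. -/
noncomputable def invGammaLaw (ν : ℝ) : Measure ℝ :=
  Measure.map (fun x => 1 / (2 * x)) (gammaMeasure ν 1)

open Filter
open scoped unitInterval Topology

/-- The iterated backward difference `∑ j, (-1) ^ j * k.choose j * a (m + j)`. -/
def iterDiff (a : ℕ → ℝ) : ℕ → ℕ → ℝ
  | 0, m => a m
  | k + 1, m => iterDiff a k m - iterDiff a k (m + 1)

lemma iterDiff_succ_const (c : ℝ) (k m : ℕ) : iterDiff (fun _ => c) (k + 1) m = 0 := by
  induction k generalizing m with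
  | zero => simp [iterDiff]
  | succ k ih => rw [iterDiff, ih, ih, sub_zero]

lemma hasDerivAt_iterDiff {a a' : ℝ → ℕ → ℝ} {z : ℝ}
    (h : ∀ m, HasDerivAt (fun z => a z m) (a' z m) z) (k m : ℕ) :
    HasDerivAt (fun z => iterDiff (a z) k m) (iterDiff (a' z) k m) z := by
  induction k generalizing m with
  | zero => exact h m
  | succ k ih => exact (ih m).sub (ih (m + 1))

lemma iterDiff_eigenvalue_eq {a a₁ a₂ : ℕ → ℝ} {c₁ c₂ : ℝ}
    (h : ∀ m, c₂ * a₂ m + c₁ * a₁ m = m * a m) (k m : ℕ) :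
    c₂ * iterDiff a₂ k m + c₁ * iterDiff a₁ k m
      = m * iterDiff a k m - k * iterDiff a (k - 1) (m + 1) := by
  induction k generalizing m with
  | zero => simpa [iterDiff] using h m
  | succ k ih =>
    have h1 := ih m
    have h2 := ih (m + 1)
    rcases k with _ | k
    · have h0 : iterDiff a 0 (m + 1) = a (m + 1) := rfl
      simp only [iterDiff, h0] at *
      push_cast at *
      linear_combination h1 - h2
    · simp only [iterDiff, Nat.add_sub_cancel] at *
      push_cast at *
      linear_combination h1 - h2

lemma tendsto_iterDiff {ι : Type*} {l : Filter ι} {a : ι → ℕ → ℝ}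
    (h : ∀ m, Tendsto (fun i => a i m) l (𝓝 (if m = 0 then 1 else 0))) (k m : ℕ) :
    Tendsto (fun i => iterDiff (a i) k m) l (𝓝 (if m = 0 then 1 else 0)) := by
  induction k generalizing m with
  | zero => exact h m
  | succ k ih => simpa [iterDiff] using (ih m).sub (ih (m + 1))

lemma not_isLocalMin_of_hasDerivAt_neg {f f' : ℝ → ℝ} {f'' z : ℝ}
    (hf : ∀ᶠ y in 𝓝 z, HasDerivAt f (f' y) y) (hf' : HasDerivAt f' f'' z) (hneg : f'' < 0) :
    ¬ IsLocalMin f z := by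
  intro hmin
  have hz := hf.self_of_nhds
  have hd : deriv f =ᶠ[𝓝 z] f' := hf.mono fun y hy => hy.deriv
  have hmax : IsLocalMax f z := isLocalMax_of_deriv_deriv_neg
    (by rwa [hd.deriv_eq, hf'.deriv]) (by rw [hz.deriv, hmin.hasDerivAt_eq_zero hz])
    hz.continuousAt
  have hconst : f =ᶠ[𝓝 z] fun _ => f z := by
    filter_upwards [hmin, hmax] with y h1 h2 using le_antisymm h2 h1
  have h0 : deriv f =ᶠ[𝓝 z] fun _ => 0 := by simpa using hconst.deriv
  have : f'' = 0 := by
    rw [← hf'.deriv, ← hd.deriv_eq, h0.deriv_eq, deriv_const]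
  exact hneg.ne this

/-- Maximum principle on a half-line. -/
lemma pos_of_strict_supersolution {f f' f'' β : ℝ → ℝ} {q l lam : ℝ} (hq : 0 ≤ q) (hlam : 0 ≤ lam)
    (hf : ∀ z, q ≤ z → ContinuousAt f z)
    (hf' : ∀ z, q < z → HasDerivAt f (f' z) z) (hf'' : ∀ z, q < z → HasDerivAt f' (f'' z) z)
    (hL : ∀ z, q < z → z * f'' z + β z * f' z < lam * f z)
    (hfq : 0 ≤ f q) (hl : 0 ≤ l) (hlim : Tendsto f atTop (𝓝 l)) {z : ℝ} (hz : q < z) :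
    0 < f z := by
  by_contra! hfz
  obtain ⟨y, hy, hfy, hmin⟩ : ∃ y, q < y ∧ f y ≤ 0 ∧ IsLocalMin f y := by
    by_cases hneg : ∃ x, q < x ∧ f x < 0
    · obtain ⟨x, hx, hfx⟩ := hneg
      obtain ⟨R, hR⟩ := eventually_atTop.1 (hlim.eventually_const_lt (hfx.trans_le hl))
      obtain ⟨y, hy, hymin⟩ := isCompact_Icc.exists_isMinOn
        (nonempty_Icc.2 (hx.le.trans (le_max_left x R)))
        (fun z hz => (hf z hz.1).continuousWithinAt)
      have hyx : f y ≤ f x := hymin ⟨hx.le, le_max_left x R⟩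
      have hqy : q < y := by
        refine lt_of_le_of_ne hy.1 ?_
        rintro rfl
        linarith
      refine ⟨y, hqy, by linarith, ?_⟩
      filter_upwards [Ioi_mem_nhds hqy] with t ht
      by_cases htR : t ≤ max x R
      · exact hymin ⟨le_of_lt ht, htR⟩
      · exact hyx.trans (hR t ((le_max_right x R).trans (not_le.1 htR).le)).le
    · push Not at hneg
      refine ⟨z, hz, hfz, ?_⟩
      filter_upwards [Ioi_mem_nhds hz] with t ht
      exact hfz.trans (hneg t ht)
  have h1 := hmin.hasDerivAt_eq_zero (hf' y hy)
  have h2 := hL y hy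
  rw [h1, mul_zero, add_zero] at h2
  have h3 : f'' y < 0 := by
    by_contra! h
    nlinarith [mul_nonneg (hq.trans hy.le) h, mul_nonneg hlam (neg_nonneg.2 hfy)]
  exact not_isLocalMin_of_hasDerivAt_neg
    ((eventually_gt_nhds hy).mono fun t ht => hf' t ht) (hf'' y hy) h3 hmin

lemma measurable_gammaPDF (a r : ℝ) : Measurable (gammaPDF a r) :=
  (measurable_gammaPDFReal a r).ennreal_ofReal

lemma ae_pos_gammaMeasure (ν : ℝ) : ∀ᵐ x ∂gammaMeasure ν 1, 0 < x := by
  rw [gammaMeasure, ae_withDensity_iff (measurable_gammaPDF ν 1)]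
  filter_upwards [Measure.ae_ne volume (0 : ℝ)] with x hx h
  by_contra! hle
  exact h (gammaPDF_of_neg (lt_of_le_of_ne hle hx))

lemma integral_gammaMeasure {ν : ℝ} (hν : 0 < ν) (f : ℝ → ℝ) :
    ∫ x, f x ∂gammaMeasure ν 1
      = (Gamma ν)⁻¹ * ∫ x in Ioi 0, x ^ (ν - 1) * exp (-x) * f x := by
  rw [gammaMeasure, integral_withDensity_eq_integral_toReal_smul
    (measurable_gammaPDF ν 1) (ae_of_all _ fun x => ENNReal.ofReal_lt_top),
    ← integral_const_mul, ← integral_indicator measurableSet_Ioi]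
  refine integral_congr_ae ?_
  filter_upwards [Measure.ae_ne volume (0 : ℝ)] with x hx
  rcases lt_or_gt_of_ne hx with h | h
  · simp [gammaPDF_of_neg h, h.le]
  · rw [indicator_of_mem (mem_Ioi.2 h), gammaPDF, ENNReal.toReal_ofReal
      (gammaPDFReal_nonneg hν one_pos x), gammaPDFReal, if_pos h.le]
    simp
    ring

lemma integrableOn_of_integrable_gammaMeasure {ν : ℝ} (hν : 0 < ν) {f : ℝ → ℝ}
    (hf : Integrable f (gammaMeasure ν 1)) :
    IntegrableOn (fun x => x ^ (ν - 1) * exp (-x) * f x) (Ioi 0) := by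
  rw [gammaMeasure, integrable_withDensity_iff_integrable_smul'
    (measurable_gammaPDF ν 1) (ae_of_all _ fun x => ENNReal.ofReal_lt_top)] at hf
  refine IntegrableOn.congr_fun (hf.const_mul (Gamma ν)).integrableOn ?_ measurableSet_Ioi
  intro x hx
  have hx : 0 < x := hx
  have := (Gamma_pos_of_pos hν).ne'
  simp only [gammaPDF]
  rw [ENNReal.toReal_ofReal (gammaPDFReal_nonneg hν one_pos x), gammaPDFReal, if_pos hx.le]
  simp
  field_simp

/-- The `m`-th moment of `G / (G + z)` for `G` of law `Gamma(ν, 1)`. -/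
noncomputable def gammaMoment (ν : ℝ) (m : ℕ) (z : ℝ) : ℝ :=
  ∫ x, (x / (x + z)) ^ m ∂gammaMeasure ν 1

lemma div_add_mem_Ioo {x z : ℝ} (hx : 0 < x) (hz : 0 < z) : x / (x + z) ∈ Ioo (0 : ℝ) 1 :=
  ⟨by positivity, (div_lt_one (by positivity)).2 (by linarith)⟩

lemma integrable_div_add_pow {ν z : ℝ} (hν : 0 < ν) (hz : 0 < z) (m : ℕ) :
    Integrable (fun x => (x / (x + z)) ^ m) (gammaMeasure ν 1) := by
  have := isProbabilityMeasure_gammaMeasure hν one_pos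
  refine Integrable.of_bound (by fun_prop : Measurable _).aestronglyMeasurable 1 ?_
  filter_upwards [ae_pos_gammaMeasure ν] with x hx
  have h := div_add_mem_Ioo hx hz
  rw [norm_eq_abs, abs_of_nonneg (by have := h.1; positivity)]
  exact pow_le_one₀ h.1.le h.2.le

lemma gammaMoment_zero {ν z : ℝ} (hν : 0 < ν) : gammaMoment ν 0 z = 1 := by
  have := isProbabilityMeasure_gammaMeasure hν one_pos
  simp [gammaMoment]

lemma gammaMoment_pos {ν z : ℝ} (hν : 0 < ν) (hz : 0 < z) (m : ℕ) : 0 < gammaMoment ν m z := by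
  have := isProbabilityMeasure_gammaMeasure hν one_pos
  have hpos : ∀ᵐ x ∂gammaMeasure ν 1, 0 < (x / (x + z)) ^ m := by
    filter_upwards [ae_pos_gammaMeasure ν] with x hx
    positivity
  rw [gammaMoment, integral_pos_iff_support_of_nonneg_ae (hpos.mono fun x hx => hx.le)
    (integrable_div_add_pow hν hz m), pos_iff_ne_zero]
  intro h0
  have : ∀ᵐ x ∂gammaMeasure ν 1, False := by
    filter_upwards [hpos, measure_eq_zero_iff_ae_notMem.1 h0] with x h1 h2
    exact h2 h1.ne'
  simp [ae_iff] at this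

lemma tendsto_gammaMoment {ν : ℝ} (hν : 0 < ν) (m : ℕ) :
    Tendsto (gammaMoment ν m) atTop (𝓝 (if m = 0 then 1 else 0)) := by
  have := isProbabilityMeasure_gammaMeasure hν one_pos
  rcases eq_or_ne m 0 with rfl | hm
  · simp [funext fun z => gammaMoment_zero (z := z) hν]
  rw [if_neg hm, show (0 : ℝ) = ∫ x, (0 : ℝ) ∂gammaMeasure ν 1 by simp]
  refine tendsto_integral_filter_of_dominated_convergence (fun _ => 1) ?_ ?_
    (integrable_const _) ?_
  · exact Eventually.of_forall fun z => (by fun_prop : Measurable _).aestronglyMeasurable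
  · filter_upwards [eventually_gt_atTop 0] with z hz
    filter_upwards [ae_pos_gammaMeasure ν] with x hx
    have h := div_add_mem_Ioo hx hz
    rw [norm_eq_abs, abs_of_nonneg (by have := h.1; positivity)]
    exact pow_le_one₀ h.1.le h.2.le
  · refine ae_of_all _ fun x => ?_
    have : Tendsto (fun z => x / (x + z)) atTop (𝓝 0) :=
      tendsto_const_nhds.div_atTop (tendsto_atTop_add_const_left _ _ tendsto_id)
    simpa [hm] using this.pow m

lemma hasDerivAt_gammaMoment {ν z : ℝ} (hν : 0 < ν) (hz : 0 < z) (m : ℕ) :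
    HasDerivAt (gammaMoment ν m) (-(m / z) * (gammaMoment ν m z - gammaMoment ν (m + 1) z)) z := by
  have := isProbabilityMeasure_gammaMeasure hν one_pos
  have key := (hasDerivAt_integral_of_dominated_loc_of_deriv_le (μ := gammaMeasure ν 1)
    (F := fun z x => (x / (x + z)) ^ m)
    (F' := fun z x => -(m / z) * ((x / (x + z)) ^ m - (x / (x + z)) ^ (m + 1)))
    (bound := fun _ => m / (z / 2)) (x₀ := z) (s := Ioi (z / 2)) (Ioi_mem_nhds (by linarith))
    (Eventually.of_forall fun z => (by fun_prop : Measurable _).aestronglyMeasurable)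
    (integrable_div_add_pow hν hz m) (by fun_prop : Measurable _).aestronglyMeasurable
    ?_ (integrable_const _) ?_).2
  · rw [integral_const_mul, integral_sub (integrable_div_add_pow hν hz m)
      (integrable_div_add_pow hν hz (m + 1))] at key
    exact key
  · filter_upwards [ae_pos_gammaMeasure ν] with x hx y hy
    have hy' : z / 2 < y := hy
    have hy0 : 0 < y := by linarith
    obtain ⟨h0, h1⟩ := div_add_mem_Ioo hx hy0
    have h2 : |(x / (x + y)) ^ m - (x / (x + y)) ^ (m + 1)| ≤ 1 := by
      have := pow_le_one₀ (n := m) h0.le h1.le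
      have := pow_le_one₀ (n := m + 1) h0.le h1.le
      have : 0 < (x / (x + y)) ^ m := by positivity
      have : 0 < (x / (x + y)) ^ (m + 1) := by positivity
      rw [abs_le]; constructor <;> linarith
    rw [norm_eq_abs, abs_mul, abs_neg, abs_of_nonneg (by positivity)]
    calc (m / y) * _ ≤ m / y * 1 := by gcongr
      _ ≤ m / (z / 2) := by rw [mul_one]; gcongr
  · filter_upwards [ae_pos_gammaMeasure ν] with x hx y hy
    have hy' : z / 2 < y := hy
    have hy0 : 0 < y := by linarith
    have hne : x + y ≠ 0 := by positivity
    have hd := (((hasDerivAt_id y).const_add x).inv hne).const_mul x |>.pow m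
    refine (hd.congr_deriv ?_ :)
    rcases m with _ | m
    · simp
    · simp only [id, Nat.add_sub_cancel, pow_succ, Pi.inv_apply]
      field_simp
      ring

lemma gammaMoment_recurrence {ν z : ℝ} (hν : 0 < ν) (hz : 0 < z) (m : ℕ) :
    (m + 1) * (gammaMoment ν m z - 2 * gammaMoment ν (m + 1) z + gammaMoment ν (m + 2) z)
      - (1 - ν) * (gammaMoment ν m z - gammaMoment ν (m + 1) z)
      - z * gammaMoment ν (m + 1) z = 0 := by
  let B : ℝ → ℝ := fun x => (m + ν) * (x / (x + z)) ^ m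
    + -(2 * (m + 1) - (1 - ν) + z) * (x / (x + z)) ^ (m + 1) + (m + 1) * (x / (x + z)) ^ (m + 2)
  have hi := integrable_div_add_pow hν hz
  have hB1 : Integrable (fun x => (m + ν) * (x / (x + z)) ^ m
    + -(2 * (m + 1) - (1 - ν) + z) * (x / (x + z)) ^ (m + 1)) (gammaMeasure ν 1) :=
    ((hi m).const_mul _).add ((hi (m + 1)).const_mul _)
  have hB : Integrable B (gammaMeasure ν 1) := hB1.add ((hi (m + 2)).const_mul _)
  have hBint : ∫ x, B x ∂gammaMeasure ν 1 = (m + ν) * gammaMoment ν m z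
      + -(2 * (m + 1) - (1 - ν) + z) * gammaMoment ν (m + 1) z
      + (m + 1) * gammaMoment ν (m + 2) z := by
    simp only [B]
    rw [integral_add hB1 ((hi (m + 2)).const_mul _),
      integral_add ((hi m).const_mul _) ((hi (m + 1)).const_mul _)]
    simp only [integral_const_mul, gammaMoment]
  have hzero : ∫ x in Ioi 0, x ^ (ν - 1) * exp (-x) * B x = 0 := by
    let F : ℝ → ℝ := fun x => z * (x ^ ν * exp (-x) * ((x / (x + z)) ^ m * (x + z)⁻¹))
    have hF0 : F 0 = 0 := by simp [F, hν.ne']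
    have hlim : Tendsto F atTop (𝓝 0) := by
      have h := (tendsto_rpow_mul_exp_neg_mul_atTop_nhds_zero ν 1 one_pos)
      refine squeeze_zero' ?_ ?_ h
      · filter_upwards [eventually_gt_atTop 0] with x hx
        positivity
      · filter_upwards [eventually_gt_atTop 0] with x hx
        have h := div_add_mem_Ioo hx hz
        have h1 : (x / (x + z)) ^ m ≤ 1 := pow_le_one₀ h.1.le h.2.le
        have h2 : z * (x + z)⁻¹ ≤ 1 := by
          rw [← div_eq_mul_inv]; exact div_le_one_of_le₀ (by linarith) (by positivity)
        have h3 : (x / (x + z)) ^ m * (z * (x + z)⁻¹) ≤ 1 :=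
          mul_le_one₀ h1 (by positivity) h2
        calc F x = x ^ ν * exp (-x) * ((x / (x + z)) ^ m * (z * (x + z)⁻¹)) := by
              simp only [F]; ring
          _ ≤ x ^ ν * exp (-x) * 1 := by gcongr
          _ = x ^ ν * exp (-1 * x) := by simp
    have hcont : ContinuousWithinAt F (Ici 0) 0 := by
      refine ContinuousAt.continuousWithinAt ?_
      have h1 : ContinuousAt (fun x : ℝ => x ^ ν) 0 := continuousAt_rpow_const _ _ (Or.inr hν.le)
      have h2 : ContinuousAt (fun x : ℝ => x + z) 0 := by fun_prop
      have h3 : (0 : ℝ) + z ≠ 0 := by simpa using hz.ne'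
      exact continuousAt_const.mul ((h1.mul (by fun_prop)).mul
        (((continuousAt_id.div h2 h3).pow m).mul (h2.inv₀ h3)))
    have hder : ∀ x ∈ Ioi (0 : ℝ), HasDerivAt F (x ^ (ν - 1) * exp (-x) * B x) x := by
      intro x hx
      have hx : 0 < x := hx
      have hne : x + z ≠ 0 := by positivity
      have h1 : HasDerivAt (fun x : ℝ => x ^ ν) (ν * x ^ (ν - 1)) x :=
        hasDerivAt_rpow_const (Or.inl hx.ne')
      have h2 : HasDerivAt (fun x : ℝ => exp (-x)) (-exp (-x)) x := by
        simpa using (hasDerivAt_neg x).exp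
      have h3 : HasDerivAt (fun x : ℝ => x + z) 1 x := (hasDerivAt_id x).add_const z
      have h4 : HasDerivAt (fun x : ℝ => x / (x + z)) ((1 * (x + z) - x * 1) / (x + z) ^ 2) x :=
        (hasDerivAt_id x).div h3 hne
      have h5 := ((h1.mul h2).mul ((h4.pow m).mul (h3.inv hne))).const_mul z
      refine h5.congr_deriv ?_
      have hpow : x ^ ν = x ^ (ν - 1) * x := by
        rw [← rpow_add_one hx.ne', sub_add_cancel]
      simp only [B, hpow, Pi.mul_apply, Pi.pow_apply, Pi.inv_apply]
      rcases m with _ | m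
      · simp
        field_simp
        ring
      · simp only [Nat.add_sub_cancel, pow_succ]
        push_cast
        field_simp
        ring
    have := integral_Ioi_of_hasDerivAt_of_tendsto hcont hder
      (integrableOn_of_integrable_gammaMeasure hν hB) hlim
    rw [this, hF0, sub_zero]
  have := integral_gammaMeasure hν B
  rw [hzero, mul_zero, hBint] at this
  linear_combination this

/-- Ratios of the moments of `G / (G + z)` at two parameters are completely monotone. -/
lemma iterDiff_gammaMoment_div_pos {ν q : ℝ} (hν : 0 < ν) (hq : 0 < q) (k m : ℕ) {z : ℝ}
    (hz : q < z) :
    0 < iterDiff (fun m => gammaMoment ν m z / gammaMoment ν m q) k m := by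
  have hpos := gammaMoment_pos hν hq
  let w : ℕ → ℝ → ℝ := gammaMoment ν
  let a : ℝ → ℕ → ℝ := fun z m => w m z / w m q
  let a₁ : ℝ → ℕ → ℝ := fun z m => -(m / z) * (w m z - w (m + 1) z) / w m q
  let a₂ : ℝ → ℕ → ℝ := fun z m =>
    m * (m + 1) / z ^ 2 * (w m z - 2 * w (m + 1) z + w (m + 2) z) / w m q
  have ha₁ : ∀ z, 0 < z → ∀ m, HasDerivAt (fun z => a z m) (a₁ z m) z := fun z hz m =>
    (hasDerivAt_gammaMoment hν hz m).div_const _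
  have ha₂ : ∀ z, 0 < z → ∀ m, HasDerivAt (fun z => a₁ z m) (a₂ z m) z := by
    intro z hz m
    have h1 := hasDerivAt_gammaMoment hν hz m
    have h2 := hasDerivAt_gammaMoment hν hz (m + 1)
    have h3 := (((hasDerivAt_inv hz.ne').const_mul (m : ℝ)).neg.mul (h1.sub h2)).div_const (w m q)
    simp only [← div_eq_mul_inv] at h3
    refine h3.congr_deriv ?_
    simp only [a₂, w, Pi.neg_apply, Pi.sub_apply]
    push_cast
    field_simp
    ring
  have heig : ∀ z, 0 < z → ∀ m, z * a₂ z m + (1 - ν - z) * a₁ z m = m * a z m := by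
    intro z hz m
    have hw : w m q ≠ 0 := (hpos m).ne'
    have h := gammaMoment_recurrence hν hz m
    simp only [a, a₁, a₂]
    field_simp
    simp only [w] at *
    linear_combination (m : ℝ) * h
  change 0 < iterDiff (a z) k m
  induction k generalizing m z with
  | zero => exact div_pos (gammaMoment_pos hν (hq.trans hz) m) (hpos m)
  | succ k ih =>
    have hlim := tendsto_iterDiff (l := atTop) (a := a) (fun m => by
      have h := (tendsto_gammaMoment hν m).div_const (w m q)
      have hc : (if m = 0 then 1 else 0) / w m q = if m = 0 then 1 else 0 := by
        rcases eq_or_ne m 0 with rfl | hm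
        · simp [w, gammaMoment_zero hν]
        · simp [hm]
      rwa [hc] at h) (k + 1) m
    refine pos_of_strict_supersolution (f := fun z => iterDiff (a z) (k + 1) m)
      (f' := fun z => iterDiff (a₁ z) (k + 1) m) (f'' := fun z => iterDiff (a₂ z) (k + 1) m)
      (β := fun z => 1 - ν - z) (lam := m) hq.le (Nat.cast_nonneg m)
      (fun z hz => (hasDerivAt_iterDiff (ha₁ z (hq.trans_le hz)) _ _).continuousAt)
      (fun z hz => hasDerivAt_iterDiff (ha₁ z (hq.trans hz)) _ _)
      (fun z hz => hasDerivAt_iterDiff (ha₂ z (hq.trans hz)) _ _)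
      (fun z hz => ?_) ?_ (by split_ifs <;> norm_num) hlim hz
    · rw [iterDiff_eigenvalue_eq (heig z (hq.trans hz))]
      have := ih (m + 1) hz
      simp only [Nat.add_sub_cancel]
      have : (0 : ℝ) < ((k + 1 : ℕ) : ℝ) * iterDiff (a z) k (m + 1) := by positivity
      linarith
    · have hone : a q = fun _ => 1 := by
        ext m
        exact div_self (hpos m).ne'
      have : ∀ m, iterDiff (a q) (k + 1) m = 0 := by
        rw [hone]
        exact iterDiff_succ_const 1 k
      exact (this m).ge

lemma sum_choose_mul_iterDiff (a : ℕ → ℝ) (n r m : ℕ) :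
    ∑ j ∈ Finset.range (n + 1), (n.choose j : ℝ) * iterDiff a (r + (n - j)) (m + j)
      = iterDiff a r m := by
  induction n generalizing r m with
  | zero => simp
  | succ n ih =>
    rw [Finset.sum_choose_succ_mul (fun i j => iterDiff a (r + j) (m + i)) n]
    have h1 : ∀ i ∈ Finset.range (n + 1), (n.choose i : ℝ) * iterDiff a (r + (n + 1 - i)) (m + i)
        = (n.choose i : ℝ) * iterDiff a (r + 1 + (n - i)) (m + i) := by
      intro i hi
      rw [show r + (n + 1 - i) = r + 1 + (n - i) by have := Finset.mem_range.1 hi; omega]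
    have h2 : ∀ i ∈ Finset.range (n + 1), (n.choose i : ℝ) * iterDiff a (r + (n - i)) (m + (i + 1))
        = (n.choose i : ℝ) * iterDiff a (r + (n - i)) (m + 1 + i) := by
      intro i hi
      rw [show m + (i + 1) = m + 1 + i by omega]
    rw [Finset.sum_congr rfl h1, Finset.sum_congr rfl h2, ih, ih, iterDiff]
    ring

lemma sum_choose_mul_descFactorial_mul_iterDiff (a : ℕ → ℝ) {n m : ℕ} (hmn : m ≤ n) :
    ∑ k ∈ Finset.range (n + 1), (n.choose k : ℝ) * iterDiff a (n - k) k * k.descFactorial m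
      = n.descFactorial m * a m := by
  obtain ⟨N, rfl⟩ := Nat.exists_eq_add_of_le hmn
  have hlow : ∑ k ∈ Finset.range m, ((m + N).choose k : ℝ) * iterDiff a (m + N - k) k
      * k.descFactorial m = 0 := by
    refine Finset.sum_eq_zero fun k hk => ?_
    rw [Nat.descFactorial_of_lt (Finset.mem_range.1 hk)]
    simp
  rw [add_assoc, Finset.sum_range_add, hlow, zero_add,
    show a m = iterDiff a 0 m from rfl, ← sum_choose_mul_iterDiff a N 0 m, Finset.mul_sum]
  refine Finset.sum_congr rfl fun j hj => ?_
  have hj' : j ≤ N := by have := Finset.mem_range.1 hj; omega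
  have key : (m + N).choose (m + j) * (m + j).descFactorial m
      = (m + N).descFactorial m * N.choose j := by
    have h := Nat.choose_mul (n := m + N) (k := m + j) (s := m) (by omega)
    simp only [Nat.add_sub_cancel_left] at h
    rw [Nat.descFactorial_eq_factorial_mul_choose, Nat.descFactorial_eq_factorial_mul_choose]
    linear_combination (m.factorial) * h
  have key' : ((m + N).choose (m + j) : ℝ) * (m + j).descFactorial m
      = (m + N).descFactorial m * N.choose j := by exact_mod_cast key
  rw [show m + N - (m + j) = 0 + (N - j) by omega]
  linear_combination iterDiff a (0 + (N - j)) (m + j) * key'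

/-- The polynomial on `[0, 1]` whose value at `k / n` is the ratio of descending factorials
of `k` and `n` of order `m`. -/
noncomputable def descRatio (n m : ℕ) : C(I, ℝ) :=
  ∏ i ∈ Finset.range m, (1 - (i : ℝ) / n)⁻¹ •
    ((⟨fun x : I => (x : ℝ), by fun_prop⟩ : C(I, ℝ)) - ((i : ℝ) / n) • 1)

lemma tendsto_descRatio (m : ℕ) :
    Tendsto (fun n => descRatio n m) atTop
      (𝓝 ((⟨fun x : I => (x : ℝ), by fun_prop⟩ : C(I, ℝ)) ^ m)) := by
  unfold descRatio
  have hpow : ((⟨fun x : I => (x : ℝ), by fun_prop⟩ : C(I, ℝ)) ^ m)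
      = ∏ i ∈ Finset.range m, (⟨fun x : I => (x : ℝ), by fun_prop⟩ : C(I, ℝ)) := by simp
  rw [hpow]
  refine tendsto_finsetProd _ fun i _ => ?_
  have h0 : Tendsto (fun n : ℕ => (i : ℝ) / n) atTop (𝓝 0) := tendsto_const_div_atTop_nhds_zero_nat _
  have h1 : Tendsto (fun n : ℕ => (1 - (i : ℝ) / n)⁻¹) atTop (𝓝 1) := by
    simpa using (h0.const_sub 1).inv₀ (by simp)
  simpa using h1.smul ((h0.smul_const (1 : C(I, ℝ))).const_sub
    (⟨fun x : I => (x : ℝ), by fun_prop⟩ : C(I, ℝ)))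

lemma descRatio_apply {n m : ℕ} (hmn : m ≤ n) (k : ℕ) (x : I) (hx : (x : ℝ) = k / n) :
    descRatio n m x * n.descFactorial m = k.descFactorial m := by
  have : ∀ i ∈ Finset.range m, (1 - (i : ℝ) / n)⁻¹ * ((k : ℝ) / n - i / n) * (n - i) = k - i := by
    intro i hi
    have hi' : (i : ℝ) < n := by
      have := Finset.mem_range.1 hi
      exact_mod_cast this.trans_le hmn
    have hn : (0 : ℝ) < n := lt_of_le_of_lt (Nat.cast_nonneg _) hi'
    have : (n : ℝ) - i ≠ 0 := by linarith
    have : 1 - (i : ℝ) / n ≠ 0 := by rw [one_sub_div hn.ne']; positivity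
    field_simp
  have hc : ∀ j : ℕ, (j.descFactorial m : ℝ) = ∏ i ∈ Finset.range m, ((j : ℝ) - i) := by
    intro j
    rw [← descPochhammer_eval_eq_descFactorial, descPochhammer_eval_eq_prod_range]
  rw [hc, hc, ← Finset.prod_congr rfl this, Finset.prod_mul_distrib]
  congr 1
  simp [descRatio, ContinuousMap.prod_apply, hx]

/-- **Hausdorff moment problem**: a normalized completely monotone sequence is the moment
sequence of a probability measure on `[0, 1]`. -/
theorem exists_probabilityMeasure_moments (a : ℕ → ℝ) (h0 : a 0 = 1)
    (ha : ∀ k m, 0 ≤ iterDiff a k m) :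
    ∃ μ : ProbabilityMeasure I, ∀ m, ∫ x, (x : ℝ) ^ m ∂(μ : Measure I) = a m := by
  let w : ℕ → ℕ → ℝ := fun n k => n.choose k * iterDiff a (n - k) k
  have hw : ∀ n k, 0 ≤ w n k := fun n k => mul_nonneg (Nat.cast_nonneg _) (ha _ _)
  let pt : ℕ → ℕ → I := fun n k => Set.projIcc 0 1 zero_le_one ((k : ℝ) / n)
  let ν : ℕ → Measure I := fun n =>
    ∑ k ∈ Finset.range (n + 1), ENNReal.ofReal (w n k) • Measure.dirac (pt n k)
  have hsum : ∀ n, ∑ k ∈ Finset.range (n + 1), w n k = 1 := by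
    intro n
    simpa [h0, w] using sum_choose_mul_descFactorial_mul_iterDiff a (Nat.zero_le n)
  have hprob : ∀ n, IsProbabilityMeasure (ν n) := by
    intro n
    refine ⟨?_⟩
    simp only [ν, Measure.coe_finsetSum, Finset.sum_apply, Measure.smul_apply, measure_univ,
      smul_eq_mul, mul_one]
    rw [← ENNReal.ofReal_sum_of_nonneg (fun k _ => hw n k), hsum, ENNReal.ofReal_one]
  have hsum_eq : ∀ n (f : C(I, ℝ)), ∫ x, f x ∂(ν n)
      = ∑ k ∈ Finset.range (n + 1), w n k * f (pt n k) := by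
    intro n f
    simp only [ν]
    rw [integral_finsetSum_measure]
    · refine Finset.sum_congr rfl fun k _ => ?_
      rw [integral_smul_measure, integral_dirac, ENNReal.toReal_ofReal (hw n k), smul_eq_mul]
    · intro k _
      exact (integrable_dirac (by simp)).smul_measure (by simp)
  have hdesc : ∀ n m, m ≤ n → ∫ x, descRatio n m x ∂(ν n) = a m := by
    intro n m hmn
    have hpos : (0 : ℝ) < n.descFactorial m := by
      exact_mod_cast Nat.pos_of_ne_zero (by rw [Ne, Nat.descFactorial_eq_zero_iff_lt]; omega)
    rw [hsum_eq]
    refine mul_right_cancel₀ hpos.ne' ?_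
    rw [mul_comm (a m), ← sum_choose_mul_descFactorial_mul_iterDiff a hmn, Finset.sum_mul]
    refine Finset.sum_congr rfl fun k hk => ?_
    rw [mul_assoc, descRatio_apply hmn k]
    have hk' : (k : ℝ) ≤ n := by
      have := Finset.mem_range.1 hk
      exact_mod_cast Nat.lt_succ_iff.1 this
    simp only [pt]
    rw [Set.projIcc_of_mem _ ⟨by positivity, div_le_one_of_le₀ hk' (Nat.cast_nonneg _)⟩]
  let P : ℕ → ProbabilityMeasure I := fun n => ⟨ν n, hprob n⟩
  obtain ⟨μ, -, hμ⟩ := (isCompact_univ (X := ProbabilityMeasure I)).ultrafilter_le_nhds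
    ((hyperfilter ℕ).map P) (by simp)
  have hμ' : Tendsto P (hyperfilter ℕ) (𝓝 μ) := hμ
  have hle : (hyperfilter ℕ : Filter ℕ) ≤ atTop := by
    rw [← Nat.cofinite_eq_atTop]; exact hyperfilter_le_cofinite
  refine ⟨μ, fun m => ?_⟩
  let X : C(I, ℝ) := ⟨fun x : I => (x : ℝ), by fun_prop⟩
  have hlim := (ProbabilityMeasure.tendsto_iff_forall_integral_tendsto.1 hμ')
    (BoundedContinuousFunction.mkOfCompact (X ^ m))
  have hlim' : Tendsto (fun n => ∫ x, (X ^ m) x ∂(ν n)) atTop (𝓝 (a m)) := by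
    have hz : Tendsto (fun n => ‖X ^ m - descRatio n m‖) atTop (𝓝 0) := by
      have := (tendsto_descRatio m).const_sub (X ^ m)
      simpa [X] using this.norm
    rw [tendsto_iff_norm_sub_tendsto_zero]
    refine squeeze_zero' (Eventually.of_forall fun n => norm_nonneg _) ?_ hz
    filter_upwards [eventually_ge_atTop m] with n hn
    have hI : ∀ f : C(I, ℝ), Integrable (fun x => f x) (ν n) := fun f =>
      f.continuous.integrable_of_hasCompactSupport (HasCompactSupport.of_compactSpace _)
    rw [← hdesc n m hn, ← integral_sub (hI _) (hI _)]
    have := norm_integral_le_of_norm_le_const (μ := ν n) (C := ‖X ^ m - descRatio n m‖)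
      (ae_of_all _ fun x => (X ^ m - descRatio n m).norm_coe_le_norm x)
    simpa using this
  have := tendsto_nhds_unique hlim (hlim'.mono_left hle)
  simpa [X] using this

/-- Finite measures on `[0, 1]` are determined by their moments. -/
theorem unitInterval_measure_ext_of_moments {μ ν : Measure I} [IsProbabilityMeasure μ]
    [IsProbabilityMeasure ν] (h : ∀ m : ℕ, ∫ x, (x : ℝ) ^ m ∂μ = ∫ x, (x : ℝ) ^ m ∂ν) :
    μ = ν := by
  have hI : ∀ (ρ : Measure I) [IsProbabilityMeasure ρ] (f : C(I, ℝ)), Integrable (fun x => f x) ρ :=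
    fun ρ _ f => f.continuous.integrable_of_hasCompactSupport (HasCompactSupport.of_compactSpace _)
  have hpoly : ∀ p : Polynomial ℝ, ∫ x, p.toContinuousMapOn I x ∂μ
      = ∫ x, p.toContinuousMapOn I x ∂ν := by
    intro p
    have hX : ∀ (ρ : Measure I) [IsProbabilityMeasure ρ] (i : ℕ),
        Integrable (fun x : I => p.coeff i * (x : ℝ) ^ i) ρ := fun ρ _ i =>
      hI ρ ⟨fun x : I => p.coeff i * (x : ℝ) ^ i, by fun_prop⟩
    simp only [Polynomial.toContinuousMapOn_apply, Polynomial.toContinuousMap_apply,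
      Polynomial.eval_eq_sum_range]
    rw [integral_finsetSum _ fun i _ => hX μ i, integral_finsetSum _ fun i _ => hX ν i]
    simp only [integral_const_mul, h]
  refine ext_of_forall_integral_eq_of_IsFiniteMeasure fun f => ?_
  refine eq_of_forall_dist_le fun ε hε => ?_
  obtain ⟨p, hp⟩ := exists_polynomial_near_continuousMap 0 1 f.toContinuousMap (ε / 2) (half_pos hε)
  have hbound : ∀ (ρ : Measure I) [IsProbabilityMeasure ρ],
      |∫ x, p.toContinuousMapOn I x ∂ρ - ∫ x, f x ∂ρ| ≤ ε / 2 := by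
    intro ρ _
    have h1 := norm_integral_le_of_norm_le_const (μ := ρ)
      (ae_of_all _ fun x => (p.toContinuousMapOn I - f.toContinuousMap).norm_coe_le_norm x)
    have h2 := integral_sub (hI ρ (p.toContinuousMapOn I)) (hI ρ f.toContinuousMap)
    change _ = ∫ x, p.toContinuousMapOn I x ∂ρ - ∫ x, f x ∂ρ at h2
    rw [← h2]
    refine le_trans ?_ hp.le
    simpa using h1
  have h1 := abs_le.1 (hbound μ)
  have h2 := abs_le.1 (hbound ν)
  have h3 := hpoly p
  rw [dist_eq, abs_le]
  constructor <;> linarith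

lemma isProbabilityMeasure_invGammaLaw {ν : ℝ} (hν : 0 < ν) :
    IsProbabilityMeasure (invGammaLaw ν) := by
  have := isProbabilityMeasure_gammaMeasure hν one_pos
  exact Measure.isProbabilityMeasure_map (by fun_prop : Measurable _).aemeasurable

lemma ae_pos_invGammaLaw (ν : ℝ) : ∀ᵐ z ∂invGammaLaw ν, 0 < z := by
  rw [invGammaLaw, ae_map_iff (by fun_prop : Measurable _).aemeasurable measurableSet_Ioi]
  filter_upwards [ae_pos_gammaMeasure ν] with x hx
  positivity

/-- The number `(1 + z / a)⁻¹`, as a point of `[0, 1]`. -/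
noncomputable def invOneAddDiv (a z : ℝ) : I := Set.projIcc 0 1 zero_le_one (1 + z / a)⁻¹

lemma measurable_invOneAddDiv (a : ℝ) : Measurable (invOneAddDiv a) :=
  continuous_projIcc.measurable.comp (by fun_prop)

lemma coe_invOneAddDiv {a z : ℝ} (ha : 0 < a) (hz : 0 < z) :
    (invOneAddDiv a z : ℝ) = (1 + z / a)⁻¹ := by
  have : 0 < z / a := by positivity
  rw [invOneAddDiv, Set.projIcc_of_mem _ ⟨by positivity, inv_le_one_of_one_le₀ (by linarith)⟩]

lemma integral_invOneAddDiv_pow (ν : ℝ) {a : ℝ} (ha : 0 < a) (m : ℕ) :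
    ∫ z, (invOneAddDiv a z : ℝ) ^ m ∂invGammaLaw ν = gammaMoment ν m (1 / (2 * a)) := by
  rw [invGammaLaw, integral_map (by fun_prop : Measurable _).aemeasurable
    (by have := measurable_invOneAddDiv a; fun_prop : Measurable _).aestronglyMeasurable,
    gammaMoment]
  refine integral_congr_ae ?_
  filter_upwards [ae_pos_gammaMeasure ν] with x hx
  rw [coe_invOneAddDiv ha (by positivity)]
  congr 1
  field_simp

/-- Multiplicative factorization of the law of `(1 + Z / b)⁻¹`. -/
lemma exists_map_invOneAddDiv_eq {ν b c : ℝ} (hν : 0 < ν) (hb : 0 < b) (hbc : b < c) :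
    ∃ μ : ProbabilityMeasure I, (invGammaLaw ν).map (invOneAddDiv b)
      = ((invGammaLaw ν).prod (μ : Measure I)).map (fun p => p.2 * invOneAddDiv c p.1) := by
  have hc : 0 < c := hb.trans hbc
  have := isProbabilityMeasure_invGammaLaw hν
  have hq : 0 < 1 / (2 * c) := by positivity
  have hqp : 1 / (2 * c) < 1 / (2 * b) := one_div_lt_one_div_of_lt (by positivity) (by linarith)
  obtain ⟨μ, hμ⟩ := exists_probabilityMeasure_moments
    (fun m => gammaMoment ν m (1 / (2 * b)) / gammaMoment ν m (1 / (2 * c)))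
    (by simp [gammaMoment_zero hν])
    (fun k m => (iterDiff_gammaMoment_div_pos hν hq k m hqp).le)
  have hmb := measurable_invOneAddDiv b
  have hmc := measurable_invOneAddDiv c
  have hm : Measurable (fun p : ℝ × I => p.2 * invOneAddDiv c p.1) :=
    measurable_snd.mul (hmc.comp measurable_fst)
  have := Measure.isProbabilityMeasure_map (μ := invGammaLaw ν) hmb.aemeasurable
  have := Measure.isProbabilityMeasure_map (μ := (invGammaLaw ν).prod (μ : Measure I)) hm.aemeasurable
  refine ⟨μ, unitInterval_measure_ext_of_moments fun m => ?_⟩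
  have hpow : Measurable (fun x : I => (x : ℝ) ^ m) := by fun_prop
  rw [integral_map hmb.aemeasurable hpow.aestronglyMeasurable,
    integral_map hm.aemeasurable hpow.aestronglyMeasurable, integral_invOneAddDiv_pow ν hb]
  simp only [Set.Icc.coe_mul, mul_pow]
  have := integral_prod_mul (μ := invGammaLaw ν) (ν := (μ : Measure I))
    (fun z => (invOneAddDiv c z : ℝ) ^ m) (fun x => (x : ℝ) ^ m)
  rw [integral_congr_ae (ae_of_all _ fun p : ℝ × I =>
    mul_comm ((p.2 : ℝ) ^ m) ((invOneAddDiv c p.1 : ℝ) ^ m)), this, hμ,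
    integral_invOneAddDiv_pow ν hc, mul_div_cancel₀ _ (gammaMoment_pos hν hq m).ne']

theorem stmt14 (ν b c : ℝ) (hν : 0 < ν) (hb : 0 < b) (hbc : b < c) :
    ∃ (Ω : Type) (_ : MeasurableSpace Ω) (P : Measure Ω) (Z X : Ω → ℝ),
      IsProbabilityMeasure P ∧ Measurable Z ∧ Measurable X ∧
      Measure.map Z P = invGammaLaw ν ∧
      (∀ ω, 0 ≤ X ω) ∧ IndepFun X Z P ∧
      Measure.map (fun ω => 1 + Z ω / b) P
        = Measure.map (fun ω => (1 + X ω / b) * (1 + Z ω / c)) P := by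
  have hc : 0 < c := hb.trans hbc
  have := isProbabilityMeasure_invGammaLaw hν
  obtain ⟨μ, hμ⟩ := exists_map_invOneAddDiv_eq hν hb hbc
  let κ := invGammaLaw ν
  let P : Measure (ℝ × I) := κ.prod (μ : Measure I)
  let X : I → ℝ := fun y => max 0 (b * ((y : ℝ)⁻¹ - 1))
  have hX : Measurable X := by fun_prop
  have hmb := measurable_invOneAddDiv b
  have hm : Measurable (fun p : ℝ × I => p.2 * invOneAddDiv c p.1) :=
    measurable_snd.mul ((measurable_invOneAddDiv c).comp measurable_fst)
  have hinv : Measurable (fun u : I => (u : ℝ)⁻¹) := by fun_prop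
  have hfst : P.map Prod.fst = κ := by simp [P, Measure.map_fst_prod]
  have hzpos : ∀ᵐ p ∂P, 0 < p.1 :=
    ae_of_ae_map measurable_fst.aemeasurable (by rw [hfst]; exact ae_pos_invGammaLaw ν)
  have hypos : ∀ᵐ p ∂P, 0 < (p.2 : ℝ) := by
    have h1 : ∀ᵐ u : I ∂κ.map (invOneAddDiv b), (0 : ℝ) < u := by
      rw [ae_map_iff hmb.aemeasurable (measurableSet_lt measurable_const (by fun_prop))]
      filter_upwards [ae_pos_invGammaLaw ν] with z hz
      rw [coe_invOneAddDiv hb hz]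
      positivity
    rw [hμ] at h1
    filter_upwards [ae_of_ae_map hm.aemeasurable h1] with p hp
    rw [Set.Icc.coe_mul] at hp
    exact pos_of_mul_pos_left hp (invOneAddDiv c p.1).2.1
  refine ⟨ℝ × I, inferInstance, P, Prod.fst, fun p => X p.2, inferInstance, measurable_fst,
    hX.comp measurable_snd, hfst, fun p => le_max_left _ _, ?_, ?_⟩
  · exact (indepFun_prod (μ := κ) (ν := (μ : Measure I)) measurable_id hX).symm
  · have hl : P.map (fun p => 1 + p.1 / b) = (κ.map (invOneAddDiv b)).map (fun u : I => (u : ℝ)⁻¹) := by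
      rw [← hfst, Measure.map_map hmb measurable_fst,
        Measure.map_map hinv (hmb.comp measurable_fst)]
      refine Measure.map_congr ?_
      filter_upwards [hzpos] with p hp
      simp [coe_invOneAddDiv hb hp]
    rw [hl, hμ, Measure.map_map hinv hm]
    refine Measure.map_congr ?_
    filter_upwards [hzpos, hypos] with p hz hy
    have h1 : 1 ≤ (p.2 : ℝ)⁻¹ := (one_le_inv₀ hy).2 p.2.2.2
    have h2 : X p.2 = b * ((p.2 : ℝ)⁻¹ - 1) :=
      max_eq_right (mul_nonneg hb.le (by linarith))
    simp only [Function.comp, Set.Icc.coe_mul, mul_inv, coe_invOneAddDiv hc hz, inv_inv, h2]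
    field_simp
    ring
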